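/- Let I, I' ⊆ Π be μ-connected and w, w' ∈ W. Then wF_I ⊆ w'F_{I'} if and only if I ⊆ I' and w^{-1}w' ∈ W_{I_*}·W_{I'} (the set of products of an element of W_{I_*} and an element of W_{I'}). -/

import Mathlib

open Set Module

noncomputable section

/-- The linear reflection `x ↦ x - f x • a` associated to a vector `a` and a linear
functional `f` with `f a = 2`, bundled as a linear automorphism. -/
def reflEquiv {V : Type*} [AddCommGroup V] [Module ℝ V]
    (a : V) (f : V →ₗ[ℝ] ℝ) (h2 : f a = 2) : V ≃ₗ[ℝ] V :=
  LinearEquiv.ofInvolutive (LinearMap.id - f.smulRight a)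
    (fun x => by
      simp only [LinearMap.sub_apply, LinearMap.id_apply, LinearMap.smulRight_apply,
        map_sub, map_smul, smul_eq_mul, h2]
      module)

/-- A realization over `ℝ` of an `m × m` generalized Cartan matrix `A`:
simple roots `α_i`, simple coroots `α_i∨` (as linear functionals), with
`⟨α_j, α_i∨⟩ = a_{ij}`, together with the defining axioms. -/
structure GCMRealization (m : ℕ) (V : Type*) [NormedAddCommGroup V] [NormedSpace ℝ V] where
  A : Matrix (Fin m) (Fin m) ℤ
  root : Fin m → V
  coroot : Fin m → V →ₗ[ℝ] ℝ
  one_le_m : 1 ≤ m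
  A_diag : ∀ i, A i i = 2
  A_offdiag : ∀ i j, i ≠ j → A i j ≤ 0
  A_zero_iff : ∀ i j, A i j = 0 ↔ A j i = 0
  root_indep : LinearIndependent ℝ root
  coroot_indep : LinearIndependent ℝ coroot
  pairing : ∀ i j, coroot i (root j) = (A i j : ℝ)
  finDim : FiniteDimensional ℝ V
  dim_eq : finrank ℝ V + (A.map ((↑) : ℤ → ℝ)).rank = 2 * m

/-- A face of a convex set `H`: a convex subset `F ⊆ H` such that whenever the open
segment between two points of `H` meets `F`, both points lie in `F`. -/
def IsFaceOf {V : Type*} [NormedAddCommGroup V] [NormedSpace ℝ V] (H F : Set V) : Prop :=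
  Convex ℝ F ∧ IsExtreme ℝ H F

namespace GCMRealization

variable {m : ℕ} {V : Type*} [NormedAddCommGroup V] [NormedSpace ℝ V]
variable (S : GCMRealization m V)

/-- The fundamental reflection `r_i`. -/
def s (i : Fin m) : V ≃ₗ[ℝ] V :=
  reflEquiv (S.root i) (S.coroot i) (by
    have h := S.pairing i i
    rw [S.A_diag i] at h
    simpa using h)

/-- The Weyl group `W`, as a subgroup of the group of linear automorphisms of `V`. -/
def W : Subgroup (V ≃ₗ[ℝ] V) := Subgroup.closure (Set.range S.s)

/-- The standard parabolic subgroup `W_I` generated by the reflections indexed by `I`. -/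
def WI (I : Set (Fin m)) : Subgroup (V ≃ₗ[ℝ] V) := Subgroup.closure (S.s '' I)

/-- The closed fundamental chamber `C̄`. -/
def chamber : Set V := {η | ∀ i, 0 ≤ S.coroot i η}

/-- `J₀`: the set of indices `i` with `⟨μ, α_i∨⟩ = 0`. -/
def J0 (μ : V) : Set (Fin m) := {i | S.coroot i μ = 0}

/-- The orbit of `μ` under a subgroup of linear automorphisms. -/
def orbitOf (G : Subgroup (V ≃ₗ[ℝ] V)) (μ : V) : Set V :=
  (fun w : V ≃ₗ[ℝ] V => w μ) '' (G : Set (V ≃ₗ[ℝ] V))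

/-- `F_I`: the convex hull of `W_I · μ`. -/
def face (μ : V) (I : Set (Fin m)) : Set V := convexHull ℝ (orbitOf (S.WI I) μ)

/-- `H`: the convex hull of the Weyl group orbit of `μ`. -/
def orbitHull (μ : V) : Set V := convexHull ℝ (orbitOf S.W μ)

/-- `ℝ₊I`: the set of nonnegative linear combinations of the simple roots indexed by `I`. -/
def coneNonneg (I : Set (Fin m)) : Set V :=
  {v | ∃ c : Fin m → ℝ, (∀ i, 0 ≤ c i) ∧ (∀ i, i ∉ I → c i = 0) ∧ v = ∑ i, c i • S.root i}

/-- `ℝ_>I`: the set of strictly positive linear combinations of the simple roots indexed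
by `I` (with `ℝ_>∅ = {0}`). -/
def conePos (I : Set (Fin m)) : Set V :=
  {v | ∃ c : Fin m → ℝ, (∀ i ∈ I, 0 < c i) ∧ (∀ i, i ∉ I → c i = 0) ∧ v = ∑ i, c i • S.root i}

/-- The open standard facet `C_J`. -/
def openFacet (J : Set (Fin m)) : Set V :=
  {η | (∀ i ∈ J, S.coroot i η = 0) ∧ ∀ i, i ∉ J → 0 < S.coroot i η}

/-- The closed standard facet `C̄_J`. -/
def closedFacet (J : Set (Fin m)) : Set V :=
  {η | (∀ i ∈ J, S.coroot i η = 0) ∧ ∀ i, i ∉ J → 0 ≤ S.coroot i η}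

/-- Adjacency of two vertices of the Dynkin diagram: `i ≠ j` and `a_{ij} ≠ 0`
(equivalently `a_{ji} ≠ 0`). -/
def Adjacent (i j : Fin m) : Prop := i ≠ j ∧ S.A i j ≠ 0 ∧ S.A j i ≠ 0

/-- The Dynkin diagram, as a simple graph on the index set. -/
def diagram : SimpleGraph (Fin m) where
  Adj := S.Adjacent
  symm := ⟨fun _ _ h => ⟨h.1.symm, h.2.2, h.2.1⟩⟩
  loopless := ⟨fun _ h => h.1 rfl⟩

/-- A subset `I` is `μ`-connected if every connected component of `I` meets
`J_> = Π \ J₀` (the empty set is `μ`-connected). -/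
def MuConnected (μ : V) (I : Set (Fin m)) : Prop :=
  ∀ i : I, ∃ j : I, S.coroot (j : Fin m) μ ≠ 0 ∧ (S.diagram.induce I).Reachable i j

/-- The connected component of `i` inside `K`, as a subset of the index set. -/
def comp (K : Set (Fin m)) (i : Fin m) : Set (Fin m) :=
  {j | ∃ (hi : i ∈ K) (hj : j ∈ K), (S.diagram.induce K).Reachable ⟨i, hi⟩ ⟨j, hj⟩}

/-- `I*`: the largest `μ`-connected subset of `I`, i.e. the union of the connected
components of `I` that meet `J_>`. -/
def muPart (μ : V) (I : Set (Fin m)) : Set (Fin m) :=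
  {j | ∃ (hj : j ∈ I) (k : Fin m) (hk : k ∈ I), S.coroot k μ ≠ 0 ∧
    (S.diagram.induce I).Reachable ⟨j, hj⟩ ⟨k, hk⟩}

/-- `I_*`: the set of `α ∈ J₀ \ I` orthogonal to all of `I`. -/
def starSet (μ : V) (I : Set (Fin m)) : Set (Fin m) :=
  {i | S.coroot i μ = 0 ∧ i ∉ I ∧ ∀ j ∈ I, S.coroot i (S.root j) = 0}

/-- A subset `K ⊆ Π` is of finite type if the subgroup `W_K` is finite. -/
def FiniteType (K : Set (Fin m)) : Prop := ((S.WI K : Subgroup (V ≃ₗ[ℝ] V)) : Set (V ≃ₗ[ℝ] V)).Finite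

/-- Every connected component of `K` is of finite type. -/
def FinTypeComponents (K : Set (Fin m)) : Prop := ∀ i ∈ K, S.FiniteType (S.comp K i)

/-- A fundamental face of `H`: a face which is empty or whose relative interior meets
the fundamental chamber. -/
def IsFundFace (μ : V) (F : Set V) : Prop :=
  IsFaceOf (S.orbitHull μ) F ∧ (F = ∅ ∨ (intrinsicInterior ℝ F ∩ S.chamber).Nonempty)

/-- The length of `w ∈ W` with respect to the fundamental reflections. -/
def len (w : V ≃ₗ[ℝ] V) : ℕ :=
  sInf {k | ∃ l : List (Fin m), l.length = k ∧ w = (l.map S.s).prod}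

end GCMRealization

end

namespace GCMRealization

variable {m : ℕ} {V : Type*} [NormedAddCommGroup V] [NormedSpace ℝ V]
variable (S : GCMRealization m V)

lemma s_apply (i : Fin m) (x : V) : S.s i x = x - S.coroot i x • S.root i := rfl

lemma coroot_self (i : Fin m) : S.coroot i (S.root i) = 2 := by
  rw [S.pairing, S.A_diag]; norm_num

lemma s_mul_self (i : Fin m) : S.s i * S.s i = 1 := by
  ext x
  simp only [LinearEquiv.mul_apply, s_apply, map_sub, map_smul, coroot_self, smul_eq_mul,
    LinearEquiv.coe_one, id_eq]
  module

lemma s_inv (i : Fin m) : (S.s i)⁻¹ = S.s i := inv_eq_of_mul_eq_one_left (S.s_mul_self i)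

lemma coroot_nonpos {i j : Fin m} (h : i ≠ j) : S.coroot i (S.root j) ≤ 0 := by
  rw [S.pairing]; exact_mod_cast S.A_offdiag i j h

/-- Product of a word. -/
noncomputable def wp (l : List (Fin m)) : V ≃ₗ[ℝ] V := (l.map S.s).prod

lemma wp_nil : S.wp [] = 1 := rfl
lemma wp_cons (i : Fin m) (l : List (Fin m)) : S.wp (i :: l) = S.s i * S.wp l := by
  simp [wp]
lemma wp_append (l l' : List (Fin m)) : S.wp (l ++ l') = S.wp l * S.wp l' := by
  simp [wp]
lemma wp_single (i : Fin m) : S.wp [i] = S.s i := by simp [wp]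

lemma s_mem {K : Set (Fin m)} {i : Fin m} (h : i ∈ K) : S.s i ∈ S.WI K :=
  Subgroup.subset_closure ⟨i, h, rfl⟩

lemma wp_mem {K : Set (Fin m)} {l : List (Fin m)} (h : ∀ i ∈ l, i ∈ K) : S.wp l ∈ S.WI K := by
  induction l with
  | nil => exact one_mem _
  | cons a l ih =>
    rw [wp_cons]
    exact mul_mem (S.s_mem (h a (by simp))) (ih fun i hi => h i (by simp [hi]))

lemma exists_word {K : Set (Fin m)} {w : V ≃ₗ[ℝ] V} (h : w ∈ S.WI K) :
    ∃ l : List (Fin m), (∀ i ∈ l, i ∈ K) ∧ S.wp l = w := by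
  induction h using Subgroup.closure_induction with
  | mem x hx =>
    obtain ⟨i, hi, rfl⟩ := hx
    exact ⟨[i], by simpa using hi, S.wp_single i⟩
  | one => exact ⟨[], by simp, rfl⟩
  | mul x y _ _ hx hy =>
    obtain ⟨l, hl, rfl⟩ := hx
    obtain ⟨l', hl', rfl⟩ := hy
    refine ⟨l ++ l', ?_, S.wp_append l l'⟩
    intro i hi
    rcases List.mem_append.1 hi with h | h
    exacts [hl i h, hl' i h]
  | inv x hx0 hx =>
    clear hx0
    obtain ⟨l, hl, rfl⟩ := hx
    refine ⟨l.reverse, by simpa using hl, ?_⟩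
    clear hl
    induction l with
    | nil => simp [wp]
    | cons a l ih => rw [List.reverse_cons, wp_append, ih, wp_single, wp_cons, mul_inv_rev, s_inv]

/-- Length relative to `K`. -/
noncomputable def ln (K : Set (Fin m)) (w : V ≃ₗ[ℝ] V) : ℕ :=
  sInf {k | ∃ l : List (Fin m), (∀ i ∈ l, i ∈ K) ∧ S.wp l = w ∧ l.length = k}

lemma ln_spec {K : Set (Fin m)} {w : V ≃ₗ[ℝ] V} (h : w ∈ S.WI K) :
    ∃ l : List (Fin m), (∀ i ∈ l, i ∈ K) ∧ S.wp l = w ∧ l.length = S.ln K w := by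
  obtain ⟨l, hl, hw⟩ := S.exists_word h
  exact Nat.sInf_mem (s := {k | ∃ l : List (Fin m), (∀ i ∈ l, i ∈ K) ∧ S.wp l = w ∧ l.length = k})
    ⟨_, l, hl, hw, rfl⟩

lemma ln_le {K : Set (Fin m)} {l : List (Fin m)} (h : ∀ i ∈ l, i ∈ K) :
    S.ln K (S.wp l) ≤ l.length := Nat.sInf_le ⟨l, h, rfl, rfl⟩

lemma ln_mul {K : Set (Fin m)} {v w : V ≃ₗ[ℝ] V} (hv : v ∈ S.WI K) (hw : w ∈ S.WI K) :
    S.ln K (v * w) ≤ S.ln K v + S.ln K w := by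
  obtain ⟨l, hl, rfl, h1⟩ := S.ln_spec hv
  obtain ⟨l', hl', rfl, h2⟩ := S.ln_spec hw
  rw [← h1, ← h2, ← wp_append, ← List.length_append]
  refine S.ln_le ?_
  intro i hi
  rcases List.mem_append.1 hi with h | h
  exacts [hl i h, hl' i h]

lemma ln_s {K : Set (Fin m)} {i : Fin m} (h : i ∈ K) : S.ln K (S.s i) ≤ 1 := by
  rw [← wp_single]; exact S.ln_le (by simpa using h)

lemma ln_one (K : Set (Fin m)) : S.ln K 1 = 0 := by
  have := S.ln_le (K := K) (l := []) (by simp)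
  simpa [wp_nil] using this

lemma WI_mono {J K : Set (Fin m)} (h : J ⊆ K) : S.WI J ≤ S.WI K :=
  Subgroup.closure_mono (Set.image_mono h)

lemma ln_mono {J K : Set (Fin m)} (h : J ⊆ K) {w : V ≃ₗ[ℝ] V} (hw : w ∈ S.WI J) :
    S.ln K w ≤ S.ln J w := by
  obtain ⟨l, hl, rfl, h1⟩ := S.ln_spec hw
  rw [← h1]
  exact S.ln_le fun i hi => h (hl i hi)

/-- coordinate functionals -/
lemma exists_coord : ∃ c : Fin m → V →ₗ[ℝ] ℝ, ∀ i j, c i (S.root j) = if i = j then 1 else 0 := by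
  classical
  obtain ⟨g, hg⟩ := LinearMap.exists_leftInverse_of_injective
    (Fintype.linearCombination ℝ S.root)
    (LinearMap.ker_eq_bot.2 (linearIndependent_iff_injective_fintypeLinearCombination.1 S.root_indep))
  refine ⟨fun i => (LinearMap.proj i).comp g, fun i j => ?_⟩
  have := congrFun (congrArg (fun f => f (Pi.single j 1)) hg) i
  simpa [Pi.single_apply] using this

noncomputable def coord (i : Fin m) : V →ₗ[ℝ] ℝ := S.exists_coord.choose i

lemma coord_root (i j : Fin m) : S.coord i (S.root j) = if i = j then 1 else 0 :=
  S.exists_coord.choose_spec i j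

/-! ### Rank two -/

lemma exists_sym (i j : Fin m) (hij : i ≠ j) : ∃ e d : ℤ, 0 < e ∧ 0 < d ∧
    e * S.A i j = d * S.A j i := by
  by_cases h : S.A i j = 0
  · exact ⟨1, 1, one_pos, one_pos, by rw [h, (S.A_zero_iff i j).1 h]⟩
  · have h' : S.A j i ≠ 0 := fun h' => h ((S.A_zero_iff i j).2 h')
    have h1 := S.A_offdiag i j hij
    have h2 := S.A_offdiag j i hij.symm
    refine ⟨-S.A j i, -S.A i j, by omega, by omega, by ring⟩

lemma rank2_data {i j : Fin m} (e d : ℤ) (hd : 0 < d)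
    (hed : e * S.A i j = d * S.A j i) (l : List (Fin m)) (hl : ∀ t ∈ l, t = i ∨ t = j) :
    ∃ p q q' : ℤ, S.wp l (S.root i) = (p : ℝ) • S.root i + (q : ℝ) • S.root j ∧
      e * p ^ 2 + e * S.A i j * p * q + d * q ^ 2 = e ∧ e * q' = d * q ∧
      ∀ y, S.coroot i ((S.wp l)⁻¹ y) = p * S.coroot i y + q' * S.coroot j y := by
  induction l with
  | nil => exact ⟨1, 0, 0, by simp [wp_nil], by ring, by ring, by simp [wp_nil]⟩
  | cons t l ih =>
    obtain ⟨p, q, q', h1, h2, h3, h4⟩ := ih fun t ht => hl t (by simp [ht])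
    have key : S.A j i * q' = S.A i j * q := by
      apply mul_left_cancel₀ hd.ne'
      linear_combination (S.A i j) * h3 - q' * hed
    have key' : (S.A j i : ℝ) * q' = S.A i j * q := by exact_mod_cast key
    rcases hl t (by simp) with rfl | rfl
    · refine ⟨-p - S.A t j * q, q, q', ?_, ?_, h3, ?_⟩
      · rw [wp_cons, LinearEquiv.mul_apply, h1]
        simp only [s_apply, map_add, map_smul, coroot_self, S.pairing, smul_eq_mul]
        rw [S.A_diag]; push_cast; module
      · linear_combination h2
      · intro y
        rw [wp_cons, mul_inv_rev, LinearEquiv.mul_apply, h4, s_inv]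
        simp only [s_apply, map_sub, map_smul, coroot_self, S.pairing, smul_eq_mul]
        rw [S.A_diag]; push_cast
        linear_combination (-S.coroot t y) * key'
    · refine ⟨p, -q - S.A t i * p, -q' - S.A i t * p, ?_, ?_, ?_, ?_⟩
      · rw [wp_cons, LinearEquiv.mul_apply, h1]
        simp only [s_apply, map_add, map_smul, coroot_self, S.pairing, smul_eq_mul]
        rw [S.A_diag]; push_cast; module
      · linear_combination h2 - (2 * p * q + S.A t i * p ^ 2) * hed
      · linear_combination -h3 - p * hed
      · intro y
        rw [wp_cons, mul_inv_rev, LinearEquiv.mul_apply, h4, s_inv]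
        simp only [s_apply, map_sub, map_smul, coroot_self, S.pairing, smul_eq_mul]
        rw [S.A_diag]; push_cast
        ring

lemma rank2_sign {a e d p q : ℤ} (ha : a ≤ 0) (he : 0 < e) (hd : 0 < d)
    (h : e * p ^ 2 + e * a * p * q + d * q ^ 2 = e) : (0 ≤ p ∧ 0 ≤ q) ∨ (p ≤ 0 ∧ q ≤ 0) := by
  by_contra hc
  have hpq : p * q < 0 := by
    rcases lt_trichotomy p 0 with hp | hp | hp <;> rcases lt_trichotomy q 0 with hq | hq | hq
    all_goals first
      | exact mul_neg_of_neg_of_pos hp hq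
      | exact mul_neg_of_pos_of_neg hp hq
      | exact absurd (by omega) hc
  have hp : p ≠ 0 := by rintro rfl; simp at hpq
  have hq : q ≠ 0 := by rintro rfl; simp at hpq
  have h1 : 1 ≤ p ^ 2 := by have : 0 < p ^ 2 := by positivity
                            omega
  have h2 : 0 < d * q ^ 2 := by positivity
  have h3 : 0 ≤ (e * a) * (p * q) :=
    mul_nonneg_of_nonpos_of_nonpos (mul_nonpos_of_nonneg_of_nonpos he.le ha) hpq.le
  nlinarith

lemma roots_pair_inj {i j : Fin m} (hij : i ≠ j) {a b c d : ℝ}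
    (h : a • S.root i + b • S.root j = c • S.root i + d • S.root j) : a = c ∧ b = d := by
  have h1 := congrArg (S.coord i) h
  have h2 := congrArg (S.coord j) h
  simp only [map_add, map_smul, coord_root, if_pos, if_neg hij, if_neg hij.symm] at h1 h2
  exact ⟨by simpa using h1, by simpa using h2⟩

lemma rank2_exch {i j : Fin m} (hij : i ≠ j) (l : List (Fin m)) (hl : ∀ t ∈ l, t = i ∨ t = j) :
    (∃ p q : ℝ, 0 ≤ p ∧ 0 ≤ q ∧ S.wp l (S.root i) = p • S.root i + q • S.root j) ∨
    ∃ l' : List (Fin m), (∀ t ∈ l', t = i ∨ t = j) ∧ l'.length < l.length ∧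
      S.wp l * S.s i = S.wp l' := by
  obtain ⟨e, d, he, hd, hed⟩ := S.exists_sym i j hij
  have ha := S.A_offdiag i j hij
  induction l with
  | nil => exact Or.inl ⟨1, 0, by simp, by simp, by simp [wp_nil]⟩
  | cons t l ih =>
    have hl' : ∀ t ∈ l, t = i ∨ t = j := fun t ht => hl t (by simp [ht])
    rcases ih hl' with hpos | ⟨l', h1, h2, h3⟩
    swap
    · refine Or.inr ⟨t :: l', ?_, by simpa using h2, by rw [wp_cons, wp_cons, mul_assoc, h3]⟩
      intro x hx
      rcases List.mem_cons.1 hx with rfl | hx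
      exacts [hl x (by simp), h1 x hx]
    obtain ⟨p, q, q', h1, h2, h3, h4⟩ := S.rank2_data e d hd hed l hl'
    obtain ⟨P, Q, Q', g1, g2, g3, g4⟩ := S.rank2_data e d hd hed (t :: l) hl
    rcases rank2_sign ha he hd g2 with ⟨hP, hQ⟩ | ⟨hP, hQ⟩
    · exact Or.inl ⟨P, Q, by exact_mod_cast hP, by exact_mod_cast hQ, g1⟩
    obtain ⟨p0, q0, hp0, hq0, h0⟩ := hpos
    obtain ⟨e1, e2⟩ := S.roots_pair_inj hij (h0.symm.trans h1)
    have hp : 0 ≤ p := by rw [e1] at hp0; exact_mod_cast hp0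
    have hq : 0 ≤ q := by rw [e2] at hq0; exact_mod_cast hq0
    refine Or.inr ⟨l, hl', by simp, ?_⟩
    have hsu : S.wp l * S.s i = S.s t * S.wp l := by
      ext y
      have hy := h4 (S.wp l y)
      rw [← LinearEquiv.mul_apply, inv_mul_cancel] at hy
      simp only [LinearEquiv.coe_one, id_eq] at hy
      rw [wp_cons, LinearEquiv.mul_apply, h1] at g1
      simp only [LinearEquiv.mul_apply, s_apply, map_sub, map_smul, h1, hy]
      simp only [s_apply, map_add, map_smul, smul_eq_mul, S.pairing] at g1
      rcases hl t (by simp) with rfl | rfl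
      · have hqQ := S.roots_pair_inj hij (a := (p : ℝ) - (p * S.A t t + q * S.A t j)) (b := q) (by
          rw [← g1]; module)
        have : q = Q := by exact_mod_cast hqQ.2
        have hq0 : q = 0 := by omega
        subst hq0
        have hq' : q' = 0 := by
          have : e * q' = 0 := by rw [h3]; ring
          rcases mul_eq_zero.1 this with h | h
          · omega
          · exact h
        have hp1 : p * p = 1 := by
          apply mul_left_cancel₀ he.ne'; linear_combination h2
        have hp1' : (p : ℝ) * p = 1 := by exact_mod_cast hp1
        subst hq'
        simp only [Int.cast_zero, zero_mul, add_zero, zero_smul, smul_smul]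
        congr 2
        linear_combination (S.coroot t (S.wp l y)) * hp1'
      · have hqQ := S.roots_pair_inj hij (a := (p : ℝ))
          (b := (q : ℝ) - (p * S.A t i + q * S.A t t)) (by rw [← g1]; module)
        have : p = P := by exact_mod_cast hqQ.1
        have hq0 : p = 0 := by omega
        subst hq0
        have hp1 : q' * q = 1 := by
          apply mul_left_cancel₀ he.ne'; linear_combination h2 + q * h3
        have hp1' : (q' : ℝ) * q = 1 := by exact_mod_cast hp1
        simp only [Int.cast_zero, zero_mul, zero_add, zero_smul, smul_smul]
        congr 2
        linear_combination (S.coroot t (S.wp l y)) * hp1'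
    rw [wp_cons, mul_assoc, hsu, ← mul_assoc, s_mul_self, one_mul]

/-! ### Cones -/

lemma cone_add {K : Set (Fin m)} {x y : V} (hx : x ∈ S.coneNonneg K) (hy : y ∈ S.coneNonneg K) :
    x + y ∈ S.coneNonneg K := by
  obtain ⟨c, h1, h2, rfl⟩ := hx
  obtain ⟨d, g1, g2, rfl⟩ := hy
  refine ⟨c + d, fun i => add_nonneg (h1 i) (g1 i), fun i hi => ?_, ?_⟩
  · simp [h2 i hi, g2 i hi]
  · simp [add_smul, Finset.sum_add_distrib]

lemma cone_smul {K : Set (Fin m)} {x : V} {r : ℝ} (hr : 0 ≤ r) (hx : x ∈ S.coneNonneg K) :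
    r • x ∈ S.coneNonneg K := by
  obtain ⟨c, h1, h2, rfl⟩ := hx
  refine ⟨r • c, fun i => mul_nonneg hr (h1 i), fun i hi => ?_, ?_⟩
  · simp [h2 i hi]
  · simp [Finset.smul_sum, smul_smul]

lemma cone_zero {K : Set (Fin m)} : (0 : V) ∈ S.coneNonneg K :=
  ⟨0, fun _ => le_rfl, fun _ _ => rfl, by simp⟩

lemma cone_root {K : Set (Fin m)} {i : Fin m} (hi : i ∈ K) : S.root i ∈ S.coneNonneg K := by
  classical
  refine ⟨Pi.single i 1, fun j => ?_, fun j hj => ?_, ?_⟩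
  · by_cases h : j = i
    · subst h; simp
    · simp [h]
  · have : j ≠ i := by rintro rfl; exact hj hi
    simp [this]
  · simp [Pi.single_apply]

lemma cone_mono {J K : Set (Fin m)} (h : J ⊆ K) : S.coneNonneg J ⊆ S.coneNonneg K := by
  rintro x ⟨c, h1, h2, rfl⟩
  exact ⟨c, h1, fun i hi => h2 i fun hj => hi (h hj), rfl⟩

lemma coord_sum (i : Fin m) (c : Fin m → ℝ) : S.coord i (∑ j, c j • S.root j) = c i := by
  simp [coord_root]

lemma coord_nonneg {K : Set (Fin m)} {x : V} (hx : x ∈ S.coneNonneg K) (i : Fin m) :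
    0 ≤ S.coord i x := by
  obtain ⟨c, h1, h2, rfl⟩ := hx
  rw [coord_sum]; exact h1 i

lemma coord_zero {K : Set (Fin m)} {x : V} (hx : x ∈ S.coneNonneg K) {i : Fin m} (hi : i ∉ K) :
    S.coord i x = 0 := by
  obtain ⟨c, h1, h2, rfl⟩ := hx
  rw [coord_sum]; exact h2 i hi

lemma cone_eq {K : Set (Fin m)} {x : V} (hx : x ∈ S.coneNonneg K) :
    x = ∑ j, S.coord j x • S.root j := by
  obtain ⟨c, h1, h2, rfl⟩ := hx
  simp only [coord_sum]

lemma cone_add_eq_zero {K : Set (Fin m)} {x y : V} (hx : x ∈ S.coneNonneg K)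
    (hy : y ∈ S.coneNonneg K) (h : x + y = 0) : x = 0 ∧ y = 0 := by
  have hx0 : x = 0 := by
    rw [S.cone_eq hx]
    refine Finset.sum_eq_zero fun i _ => ?_
    have h1 := S.coord_nonneg hx i
    have h2 := S.coord_nonneg hy i
    have h3 : S.coord i x + S.coord i y = 0 := by rw [← map_add, h, map_zero]
    have : S.coord i x = 0 := by linarith
    rw [this, zero_smul]
  exact ⟨hx0, by simpa [hx0] using h⟩

lemma coord_WI {K : Set (Fin m)} {w : V ≃ₗ[ℝ] V} (hw : w ∈ S.WI K) {i : Fin m} (hi : i ∉ K)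
    (x : V) : S.coord i (w x) = S.coord i x := by
  obtain ⟨l, hl, rfl⟩ := S.exists_word hw
  clear hw
  induction l with
  | nil => simp [wp_nil]
  | cons a l ih =>
    have hai : i ≠ a := by rintro rfl; exact hi (hl i (by simp))
    rw [wp_cons, LinearEquiv.mul_apply, s_apply, map_sub, map_smul, coord_root, if_neg hai,
      smul_zero, sub_zero, ih fun i hi => hl i (by simp [hi])]

/-! ### Key positivity lemma -/

lemma key_pos {K : Set (Fin m)} (n : ℕ) : ∀ w ∈ S.WI K, S.ln K w = n → ∀ i ∈ K,
    S.ln K w ≤ S.ln K (w * S.s i) → w (S.root i) ∈ S.coneNonneg K := by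
  induction n using Nat.strong_induction_on with
  | _ n IH =>
  intro w hw hn i hi hle
  obtain ⟨l, hl, hlw, hlen⟩ := S.ln_spec hw
  rcases List.eq_nil_or_concat l with rfl | ⟨l₀, j, rfl⟩
  · rw [← hlw, wp_nil]; exact S.cone_root hi
  simp only [List.concat_eq_append] at hl hlw hlen
  have hj : j ∈ K := hl j (by simp)
  have hl₀ : ∀ i ∈ l₀, i ∈ K := fun i hi => hl i (by simp [hi])
  have hwj : w * S.s j = S.wp l₀ := by
    rw [← hlw, wp_append, wp_single, mul_assoc, s_mul_self, mul_one]
  have hlnj : S.ln K (w * S.s j) < S.ln K w := by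
    rw [hwj, ← hlen, List.length_append]
    have := S.ln_le hl₀
    simp; omega
  have hij : i ≠ j := by rintro rfl; omega
  set P : Set (Fin m) := {i, j} with hP
  have hPK : P ⊆ K := by rintro x (rfl | rfl) <;> assumption
  have hiP : i ∈ P := by simp [hP]
  have hjP : j ∈ P := by simp [hP]
  let good : ℕ → Prop := fun k => ∃ v ∈ S.WI K, v⁻¹ * w ∈ S.WI P ∧
    S.ln K v + S.ln P (v⁻¹ * w) ≤ S.ln K w ∧ S.ln K v = k
  have hgood : ∃ k, k < S.ln K w ∧ good k := by
    refine ⟨S.ln K (w * S.s j), hlnj, w * S.s j, mul_mem hw (S.s_mem hj), ?_, ?_, rfl⟩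
    · rw [mul_inv_rev, mul_assoc, inv_mul_cancel, mul_one, s_inv]; exact S.s_mem hjP
    · rw [mul_inv_rev, mul_assoc, inv_mul_cancel, mul_one, s_inv]
      have := S.ln_s hjP
      omega
  classical
  have hex : ∃ k, good k := hgood.imp fun k h => h.2
  obtain ⟨v, hv, hx, hsum, hvk⟩ := Nat.find_spec hex
  have hvn : S.ln K v < n := by
    obtain ⟨k, hk, hg⟩ := hgood
    have := Nat.find_min' hex hg
    omega
  have hvt : ∀ t ∈ P, v (S.root t) ∈ S.coneNonneg K := by
    intro t ht
    refine IH _ hvn v hv rfl t (hPK ht) ?_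
    by_contra hlt
    push Not at hlt
    have hg : good (S.ln K (v * S.s t)) := by
      have hrw : (v * S.s t)⁻¹ * w = S.s t * (v⁻¹ * w) := by
        rw [mul_inv_rev, s_inv, mul_assoc]
      refine ⟨v * S.s t, mul_mem hv (S.s_mem (hPK ht)), ?_, ?_, rfl⟩
      · rw [hrw]; exact mul_mem (S.s_mem ht) hx
      · rw [hrw]
        have h1 := S.ln_mul (S.s_mem ht) hx
        have h2 := S.ln_s ht
        omega
    have := Nat.find_min' hex hg
    omega
  have hxi : S.ln P (v⁻¹ * w) ≤ S.ln P (v⁻¹ * w * S.s i) := by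
    by_contra hlt
    push Not at hlt
    have hm : v⁻¹ * w * S.s i ∈ S.WI P := mul_mem hx (S.s_mem hiP)
    have h1 := S.ln_mul hv (S.WI_mono hPK hm)
    have h2 := S.ln_mono hPK hm
    have h3 : v * (v⁻¹ * w * S.s i) = w * S.s i := by group
    rw [h3] at h1
    omega
  obtain ⟨lx, hlx, hlxw, hlxn⟩ := S.ln_spec hx
  rcases S.rank2_exch hij lx (by simpa [hP] using hlx) with ⟨p, q, hp, hq, h⟩ | ⟨l', h1, h2, h3⟩
  · have : w (S.root i) = p • v (S.root i) + q • v (S.root j) := by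
      rw [← map_smul, ← map_smul, ← map_add, ← h, hlxw, ← LinearEquiv.mul_apply]
      congr 1; group
    rw [this]
    exact S.cone_add (S.cone_smul hp (hvt i hiP)) (S.cone_smul hq (hvt j hjP))
  · exfalso
    have : S.ln P (S.wp l') ≤ l'.length := S.ln_le (by simpa [hP] using h1)
    rw [← h3, hlxw] at this
    omega

lemma stab {K : Set (Fin m)} {x : V} (hx : ∀ k ∈ K, 0 ≤ S.coroot k x) (n : ℕ) :
    ∀ w ∈ S.WI K, S.ln K w = n → x - w x ∈ S.coneNonneg K ∧
      (w x = x → w ∈ S.WI {k | k ∈ K ∧ S.coroot k x = 0}) := by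
  induction n with
  | zero =>
    intro w hw hn
    obtain ⟨l, hl, hlw, hlen⟩ := S.ln_spec hw
    rw [hn, List.length_eq_zero_iff] at hlen
    subst hlen
    rw [wp_nil] at hlw
    subst hlw
    simp only [LinearEquiv.coe_one, id_eq, sub_self]
    exact ⟨S.cone_zero, fun _ => one_mem _⟩
  | succ n IH =>
    intro w hw hn
    obtain ⟨l, hl, hlw, hlen⟩ := S.ln_spec hw
    rcases List.eq_nil_or_concat l with rfl | ⟨l₀, j, rfl⟩
    · simp at hlen; omega
    simp only [List.concat_eq_append] at hl hlw hlen
    have hj : j ∈ K := hl j (by simp)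
    have hl₀ : ∀ i ∈ l₀, i ∈ K := fun i hi => hl i (by simp [hi])
    have hv : S.wp l₀ ∈ S.WI K := S.wp_mem hl₀
    have hwv : w = S.wp l₀ * S.s j := by rw [← hlw, wp_append, wp_single]
    have h1 := S.ln_le hl₀
    have h2 := S.ln_mul hv (S.s_mem hj)
    have h3 := S.ln_s hj
    rw [← hwv] at h2
    simp only [List.length_append, List.length_cons, List.length_nil] at hlen
    have h4 : S.ln K (S.wp l₀) = n := by omega
    obtain ⟨i1, i2⟩ := IH _ hv h4
    have hpos := S.key_pos _ _ hv rfl j hj (by rw [← hwv]; omega)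
    have hpos' := S.cone_smul (hx j hj) hpos
    have heq : x - w x = (x - S.wp l₀ x) + S.coroot j x • S.wp l₀ (S.root j) := by
      rw [hwv, LinearEquiv.mul_apply, s_apply, map_sub, map_smul]; abel
    refine ⟨heq ▸ S.cone_add i1 hpos', fun hwx => ?_⟩
    rw [hwx, sub_self] at heq
    obtain ⟨z1, z2⟩ := S.cone_add_eq_zero i1 hpos' heq.symm
    have hroot : S.wp l₀ (S.root j) ≠ 0 := by
      rw [Ne, LinearEquiv.map_eq_zero_iff]; exact S.root_indep.ne_zero j
    have hc : S.coroot j x = 0 := (smul_eq_zero.1 z2).resolve_right hroot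
    rw [hwv]
    exact mul_mem (i2 (sub_eq_zero.1 z1).symm) (S.s_mem ⟨hj, hc⟩)

lemma W_eq : S.W = S.WI Set.univ := by simp [W, WI]

lemma WI_le_W (K : Set (Fin m)) : S.WI K ≤ S.W := by
  rw [W_eq]; exact S.WI_mono (Set.subset_univ _)

lemma cone_convex (K : Set (Fin m)) (μ : V) : Convex ℝ {y | μ - y ∈ S.coneNonneg K} := by
  intro x hx y hy a b ha hb hab
  have : μ - (a • x + b • y) = a • (μ - x) + b • (μ - y) := by
    have : μ = (a + b) • μ := by rw [hab, one_smul]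
    conv_lhs => rw [this]
    module
  change μ - (a • x + b • y) ∈ S.coneNonneg K
  rw [this]
  exact S.cone_add (S.cone_smul ha hx) (S.cone_smul hb hy)

lemma face_sub {μ : V} (hμ : μ ∈ S.chamber) (K : Set (Fin m)) {y : V} (hy : y ∈ S.face μ K) :
    μ - y ∈ S.coneNonneg K := by
  refine convexHull_min (s := orbitOf (S.WI K) μ) ?_ (S.cone_convex K μ) hy
  rintro _ ⟨w, hw, rfl⟩
  exact (S.stab (fun k _ => hμ k) _ w hw rfl).1

lemma mem_face {μ : V} {K : Set (Fin m)} {w : V ≃ₗ[ℝ] V} (hw : w ∈ S.WI K) :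
    w μ ∈ S.face μ K := subset_convexHull _ _ ⟨w, hw, rfl⟩

/-- image of the face under an element of the parabolic subgroup -/
lemma face_inv {μ : V} {K : Set (Fin m)} {b : V ≃ₗ[ℝ] V} (hb : b ∈ S.WI K) {y : V}
    (hy : y ∈ S.face μ K) : b y ∈ S.face μ K := by
  have h : (b : V →ₗ[ℝ] V) '' S.face μ K ⊆ S.face μ K := by
    rw [face, LinearMap.image_convexHull]
    refine convexHull_mono ?_
    rintro _ ⟨_, ⟨w, hw, rfl⟩, rfl⟩
    exact ⟨b * w, mul_mem hb hw, rfl⟩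
  exact h ⟨y, hy, rfl⟩

lemma extreme {μ : V} (hμ : μ ∈ S.chamber) {K : Set (Fin m)} {u : V ≃ₗ[ℝ] V} (hu : u ∈ S.W)
    {x : V} (hx : x ∈ S.face μ K) (hux : u x = μ) : ∃ b ∈ S.WI K, u (b μ) = μ := by
  by_contra hc
  push Not at hc
  let h : V →ₗ[ℝ] ℝ := ∑ i, S.coord i
  have hmem : u x ∈ {y | h y < h μ} := by
    have hh : (u : V →ₗ[ℝ] V) '' S.face μ K ⊆ {y | h y < h μ} := by
      rw [face, LinearMap.image_convexHull]
      refine convexHull_min ?_ (convex_halfSpace_lt h.isLinear _)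
      rintro _ ⟨_, ⟨w, hw, rfl⟩, rfl⟩
      have hne := hc w hw
      have hcone := (S.stab (K := Set.univ) (fun k _ => hμ k) _ (u * w) (by
        rw [← W_eq]; exact mul_mem hu (S.WI_le_W K hw)) rfl).1
      rw [LinearEquiv.mul_apply] at hcone
      have h0 : 0 ≤ h (μ - u (w μ)) := by
        simp only [h, LinearMap.sum_apply]
        exact Finset.sum_nonneg fun i _ => S.coord_nonneg hcone i
      have h1 : h (μ - u (w μ)) ≠ 0 := by
        intro h1
        simp only [h, LinearMap.sum_apply] at h1
        rw [Finset.sum_eq_zero_iff_of_nonneg fun i _ => S.coord_nonneg hcone i] at h1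
        apply hne
        have := S.cone_eq hcone
        rw [Finset.sum_eq_zero fun i hi => by rw [h1 i hi, zero_smul]] at this
        exact (sub_eq_zero.1 this).symm
      have h2 := lt_of_le_of_ne h0 h1.symm
      rw [map_sub] at h2
      simp only [Set.mem_ofPred_eq, LinearEquiv.coe_coe]
      linarith
    exact hh ⟨x, hx, rfl⟩
  rw [hux] at hmem
  have hlt : h μ < h μ := hmem
  exact lt_irrefl _ hlt

/-- `-α_i` is `K`-dominant for `i ∉ K`. -/
lemma root_sub {K : Set (Fin m)} {i : Fin m} (hi : i ∉ K) {u : V ≃ₗ[ℝ] V} (hu : u ∈ S.WI K) :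
    u (S.root i) - S.root i ∈ S.coneNonneg K ∧
      (u (S.root i) = S.root i → u ∈ S.WI {k | k ∈ K ∧ S.coroot k (S.root i) = 0}) := by
  have hd : ∀ k ∈ K, 0 ≤ S.coroot k (-S.root i) := by
    intro k hk
    have : k ≠ i := by rintro rfl; exact hi hk
    rw [map_neg]
    linarith [S.coroot_nonpos this]
  obtain ⟨h1, h2⟩ := S.stab hd _ u hu rfl
  simp only [map_neg, sub_neg_eq_add, neg_inj, neg_eq_zero] at h1 h2
  refine ⟨?_, h2⟩
  rwa [neg_add_eq_sub] at h1

/-- Connectedness: a proper subset of a `μ`-connected set can be extended. -/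
lemma exists_next {μ : V} {I T : Set (Fin m)} (hI : S.MuConnected μ I) (hT : T ⊆ I)
    (hne : T ≠ I) : ∃ i ∈ I, i ∉ T ∧ (S.coroot i μ ≠ 0 ∨ ∃ t ∈ T, S.coroot i (S.root t) ≠ 0) := by
  by_contra hc
  push Not at hc
  apply hne
  refine Set.Subset.antisymm hT fun i hi => ?_
  obtain ⟨j, hj, ⟨p⟩⟩ := hI ⟨i, hi⟩
  have hjT : (j : Fin m) ∈ T := by
    by_contra h
    exact hj (hc j j.2 h).1
  have key : ∀ {a b : I}, (S.diagram.induce I).Walk a b → (b : Fin m) ∈ T → (a : Fin m) ∈ T := by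
    intro a b p
    induction p with
    | nil => exact id
    | @cons a b c hab p ih =>
      intro hcT
      have hb := ih hcT
      by_contra ha
      have := (hc a a.2 ha).2 b hb
      rw [S.pairing] at this
      have hA : S.Adjacent a b := hab
      exact hA.2.1 (by exact_mod_cast this)
  exact key p hjT

/-- The main inductive step. -/
lemma step {μ : V} (hμ : μ ∈ S.chamber) {I' T : Set (Fin m)} {i : Fin m} {u : V ≃ₗ[ℝ] V}
    (hfix : ∀ t ∈ T, u (S.root t) = S.root t) 
    {K : Set (Fin m)} (hK : u ∈ S.WI K) (hiK : i ∉ K) (hTK : ∀ t ∈ T, t ∉ K) (hiT : i ∉ T)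
    (huμ : u μ = μ) (hpos : ∀ j ∈ I', u (S.root j) ∈ S.coneNonneg Set.univ)
    {x y : V} (hx : μ - x ∈ S.conePos (insert i T)) (hy : y ∈ S.face μ I') (hxy : u y = x) :
    i ∈ I' ∧ u (S.root i) = S.root i := by
  obtain ⟨c, hc1, hc2, hc⟩ := hx
  obtain ⟨d, hd1, hd2, hd⟩ := S.face_sub hμ I' hy
  have hsum : ∑ j, c j • S.root j = ∑ j, d j • u (S.root j) := by
    rw [← hc, ← hxy]
    nth_rewrite 1 [← huμ]
    rw [← map_sub, hd, map_sum]
    simp only [map_smul]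
  have hco : ∀ k, c k = ∑ j, d j * S.coord k (u (S.root j)) := by
    intro k
    have := congrArg (S.coord k) hsum
    rw [coord_sum, map_sum] at this
    simpa using this
  have hnn : ∀ k j, 0 ≤ d j * S.coord k (u (S.root j)) := by
    intro k j
    by_cases hj : j ∈ I'
    · exact mul_nonneg (hd1 j) (S.coord_nonneg (hpos j hj) k)
    · rw [hd2 j hj, zero_mul]
  have hci := hc1 i (by simp)
  obtain ⟨j, hj⟩ : ∃ j, 0 < d j * S.coord i (u (S.root j)) := by
    by_contra hcon
    push Not at hcon
    have := Finset.sum_nonpos (s := Finset.univ) fun j _ => hcon j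
    rw [← hco i] at this
    linarith
  have hdj : 0 < d j := lt_of_le_of_ne (hd1 j) (by rintro h; rw [← h] at hj; simp at hj)
  have hei : 0 < S.coord i (u (S.root j)) := by
    by_contra h; push Not at h; nlinarith
  have hjI' : j ∈ I' := by by_contra h; rw [hd2 j h] at hdj; exact lt_irrefl _ hdj
  -- `u` preserves the `i`-coordinate
  rw [S.coord_WI hK hiK, coord_root] at hei
  have hij : i = j := by by_contra h; rw [if_neg h] at hei; exact lt_irrefl _ hei
  subst hij
  refine ⟨hjI', ?_⟩
  have hcone := hpos i hjI'
  rw [S.cone_eq hcone]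
  rw [Finset.sum_eq_single i]
  · rw [S.coord_WI hK hiK, coord_root, if_pos rfl, one_smul]
  · intro k _ hki
    suffices S.coord k (u (S.root i)) = 0 by rw [this, zero_smul]
    by_cases hkT : k ∈ T
    · rw [S.coord_WI hK (hTK k hkT), coord_root, if_neg hki]
    · have h0 := hc2 k (by simp [hki, hkT])
      rw [hco k, Finset.sum_eq_zero_iff_of_nonneg fun j _ => hnn k j] at h0
      exact (mul_eq_zero.1 (h0 i (Finset.mem_univ _))).resolve_left hdj.ne'
  · simp

lemma core {μ : V} (hμ : μ ∈ S.chamber) {I I' : Set (Fin m)} (hI : S.MuConnected μ I)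
    {u : V ≃ₗ[ℝ] V} (hu : u ∈ S.WI (S.J0 μ)) (huμ : u μ = μ)
    (hpos : ∀ j ∈ I', u (S.root j) ∈ S.coneNonneg Set.univ)
    (hsub : ∀ x ∈ S.face μ I, ∃ y ∈ S.face μ I', u y = x) :
    I ⊆ I' ∧ u ∈ S.WI (S.starSet μ I) := by
  let KT : Set (Fin m) → Set (Fin m) := fun T => {k | k ∈ S.J0 μ ∧ ∀ t ∈ T, S.coroot k (S.root t) = 0}
  let good : Set (Fin m) → Prop := fun T => T ⊆ I ∧ T ⊆ I' ∧ (∀ t ∈ T, u (S.root t) = S.root t) ∧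
    u ∈ S.WI (KT T) ∧ ∃ g ∈ S.WI I, μ - g μ ∈ S.conePos T
  have h0 : good ∅ := by
    refine ⟨by simp, by simp, by simp, ?_, 1, one_mem _, 0, by simp, by simp, by simp⟩
    simpa [KT] using hu
  obtain ⟨T, hTm⟩ := (Set.toFinite {T | good T}).exists_maximal ⟨∅, h0⟩
  obtain ⟨hTI, hTI', hfix, hK, g, hg, hgc⟩ := hTm.prop
  have hTK : ∀ t ∈ T, t ∉ KT T := by
    intro t ht h
    have := h.2 t ht
    rw [coroot_self] at this
    norm_num at this
  by_cases hT : T = I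
  · subst hT
    refine ⟨hTI', S.WI_mono ?_ hK⟩
    intro k hk
    exact ⟨hk.1, fun h => hTK k h hk, hk.2⟩
  exfalso
  obtain ⟨i, hiI, hiT, hor⟩ := S.exists_next hI hTI hT
  have hiK : i ∉ KT T := by
    intro h
    rcases hor with h1 | ⟨t, ht, h1⟩
    · exact h1 h.1
    · exact h1 (h.2 t ht)
  have hgc' : μ - (S.s i * g) μ ∈ S.conePos (insert i T) := by
    classical
    obtain ⟨c, hc1, hc2, hc⟩ := hgc
    have hcn : ∀ t, 0 ≤ c t := fun t => by
      by_cases ht : t ∈ T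
      · exact (hc1 t ht).le
      · rw [hc2 t ht]
    have hg' : g μ = μ - ∑ t, c t • S.root t := by rw [← hc]; abel
    have hval : S.coroot i (g μ) = S.coroot i μ + ∑ t, c t * (-S.coroot i (S.root t)) := by
      rw [hg', map_sub, map_sum]
      simp [sub_eq_add_neg]
    have hterm : ∀ t, 0 ≤ c t * (-S.coroot i (S.root t)) := by
      intro t
      by_cases hti : i = t
      · subst hti; rw [hc2 i hiT, zero_mul]
      · exact mul_nonneg (hcn t) (by linarith [S.coroot_nonpos hti])
    have hpos : 0 < S.coroot i (g μ) := by
      rw [hval]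
      rcases hor with h1 | ⟨t, ht, h1⟩
      · exact add_pos_of_pos_of_nonneg (lt_of_le_of_ne (hμ i) h1.symm)
          (Finset.sum_nonneg fun t _ => hterm t)
      · refine add_pos_of_nonneg_of_pos (hμ i)
          (Finset.sum_pos' (fun t _ => hterm t) ⟨t, Finset.mem_univ _, ?_⟩)
        have hti : i ≠ t := by rintro rfl; exact hiT ht
        refine mul_pos (hc1 t ht) ?_
        have := lt_of_le_of_ne (S.coroot_nonpos hti) h1
        linarith
    refine ⟨c + Pi.single i (S.coroot i (g μ)), ?_, ?_, ?_⟩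
    · rintro t (rfl | ht)
      · simp [hc2 t hiT, hpos]
      · have hti : t ≠ i := by rintro rfl; exact hiT ht
        simp [hti, hc1 t ht]
    · intro t ht
      simp only [Set.mem_insert_iff, not_or] at ht
      simp [ht.1, hc2 t ht.2]
    · rw [LinearEquiv.mul_apply, s_apply]
      simp only [Pi.add_apply, add_smul, Finset.sum_add_distrib, ← hc]
      simp only [Pi.single_apply, ite_smul, zero_smul, Finset.sum_ite_eq', Finset.mem_univ,
        if_true]
      abel
  have hgm : S.s i * g ∈ S.WI I := mul_mem (S.s_mem hiI) hg
  obtain ⟨y, hy, hyx⟩ := hsub _ (S.mem_face hgm)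
  obtain ⟨r1, r2⟩ := S.step hμ hfix hK hiK hTK hiT huμ hpos hgc' hy hyx
  have hnew : good (insert i T) := by
    refine ⟨Set.insert_subset hiI hTI, Set.insert_subset r1 hTI', ?_, ?_, _, hgm, hgc'⟩
    · rintro t (rfl | ht)
      exacts [r2, hfix t ht]
    · refine S.WI_mono ?_ ((S.root_sub hiK hK).2 r2)
      rintro k ⟨hk, hk'⟩
      refine ⟨hk.1, ?_⟩
      rintro t (rfl | ht)
      exacts [hk', hk.2 t ht]
  exact hiT (hTm.le_of_ge hnew (Set.subset_insert i T) (Set.mem_insert i T))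

lemma forward {μ : V} (hμ : μ ∈ S.chamber) {I I' : Set (Fin m)} (hI : S.MuConnected μ I)
    {u : V ≃ₗ[ℝ] V} (hu : u ∈ S.W)
    (hsub : ∀ x ∈ S.face μ I, ∃ y ∈ S.face μ I', u y = x) :
    I ⊆ I' ∧ ∃ a ∈ S.WI (S.starSet μ I), ∃ b ∈ S.WI I', u = a * b := by
  obtain ⟨x, hx, hux⟩ := hsub μ (S.mem_face (w := 1) (one_mem _))
  obtain ⟨b, hb, hub⟩ := S.extreme hμ hu hx hux
  have hub0 : u * b ∈ S.WI (S.J0 μ) := by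
    refine S.WI_mono ?_ ((S.stab (K := Set.univ) (fun k _ => hμ k) _ (u * b) (by
        rw [← W_eq]; exact mul_mem hu (S.WI_le_W _ hb)) rfl).2 hub)
    exact fun k hk => hk.2
  -- minimal element
  let P : ℕ → Prop := fun n => ∃ b ∈ S.WI I', u * b ∈ S.WI (S.J0 μ) ∧ S.ln (S.J0 μ) (u * b) = n
  classical
  have hP : ∃ n, P n := ⟨_, b, hb, hub0, rfl⟩
  obtain ⟨b1, hb1, hu1, hlen⟩ := Nat.find_spec hP
  have hfixμ : (u * b1) μ = μ := by
    have : ∀ w ∈ S.WI (S.J0 μ), w μ = μ := by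
      intro w hw
      induction hw using Subgroup.closure_induction with
      | mem x hx =>
        obtain ⟨i, hi, rfl⟩ := hx
        have : S.coroot i μ = 0 := hi
        rw [s_apply, this, zero_smul, sub_zero]
      | one => rfl
      | mul x y _ _ hx hy => rw [LinearEquiv.mul_apply, hy, hx]
      | inv x _ hx =>
        conv_lhs => rw [← hx]
        rw [← LinearEquiv.mul_apply, inv_mul_cancel]; rfl
    exact this _ hu1
  have hpos : ∀ j ∈ I', (u * b1) (S.root j) ∈ S.coneNonneg Set.univ := by
    intro j hj
    by_cases hj0 : j ∈ S.J0 μ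
    · refine S.cone_mono (Set.subset_univ _) (S.key_pos _ _ hu1 rfl j hj0 ?_)
      rw [hlen]
      refine Nat.find_min' hP ⟨b1 * S.s j, mul_mem hb1 (S.s_mem hj), ?_, ?_⟩
      · rw [← mul_assoc]; exact mul_mem hu1 (S.s_mem hj0)
      · rw [← mul_assoc]
    · have h1 := (S.root_sub hj0 hu1).1
      have := S.cone_add (S.cone_mono (Set.subset_univ _) h1) (S.cone_root (Set.mem_univ j))
      simpa using this
  obtain ⟨h1, h2⟩ := S.core hμ hI hu1 hfixμ hpos (by
    intro x hx
    obtain ⟨y, hy, hyx⟩ := hsub x hx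
    refine ⟨b1⁻¹ y, S.face_inv (inv_mem hb1) hy, ?_⟩
    rw [← LinearEquiv.mul_apply, mul_assoc, mul_inv_cancel, mul_one, hyx])
  exact ⟨h1, _, h2, b1⁻¹, inv_mem hb1, by group⟩

lemma backward {μ : V} {I I' : Set (Fin m)} (h : I ⊆ I') {a b : V ≃ₗ[ℝ] V}
    (ha : a ∈ S.WI (S.starSet μ I)) (hb : b ∈ S.WI I') {x : V} (hx : x ∈ S.face μ I) :
    ∃ y ∈ S.face μ I', (a * b) y = x := by
  have hax : ∀ i ∈ S.starSet μ I, ∀ g ∈ S.WI I, S.s i (g μ) = g μ := by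
    intro i hi g hg
    have : S.coroot i (g μ) = 0 := by
      obtain ⟨l, hl, rfl⟩ := S.exists_word hg
      clear hg
      induction l with
      | nil => exact hi.1
      | cons t l ih =>
        rw [wp_cons, LinearEquiv.mul_apply, s_apply, map_sub, map_smul,
          hi.2.2 t (hl t (by simp)), ih fun i hi => hl i (by simp [hi])]
        simp
    rw [s_apply, this, zero_smul, sub_zero]
  have hfix : ∀ i ∈ S.starSet μ I, ∀ x ∈ S.face μ I, S.s i x = x := by
    intro i hi x hx
    have hc : Convex ℝ {x | S.s i x = x} := by
      intro x hx y hy p q _ _ _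
      have hx' : S.s i x = x := hx
      have hy' : S.s i y = y := hy
      simp [hx', hy']
    refine convexHull_min (s := orbitOf (S.WI I) μ) ?_ hc hx
    rintro _ ⟨g, hg, rfl⟩
    exact hax i hi g hg
  have hafix : a x = x := by
    induction ha using Subgroup.closure_induction with
    | mem y hy =>
      obtain ⟨i, hi, rfl⟩ := hy
      exact hfix i hi x hx
    | one => rfl
    | mul y z _ _ hy hz => rw [LinearEquiv.mul_apply, hz, hy]
    | inv y _ hy =>
      conv_lhs => rw [← hy]
      rw [← LinearEquiv.mul_apply, inv_mul_cancel]; rfl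
  have hx' : x ∈ S.face μ I' := by
    refine convexHull_mono ?_ hx
    rintro _ ⟨g, hg, rfl⟩
    exact ⟨g, S.WI_mono h hg, rfl⟩
  refine ⟨b⁻¹ x, S.face_inv (inv_mem hb) hx', ?_⟩
  rw [← LinearEquiv.mul_apply, mul_assoc, mul_inv_cancel, mul_one, hafix]

end GCMRealization

open GCMRealization in
theorem statement_13 {m : ℕ} {V : Type*} [NormedAddCommGroup V] [NormedSpace ℝ V]
    (S : GCMRealization m V) (μ : V) (hμ : μ ∈ S.chamber)
    (I I' : Set (Fin m)) (hI : S.MuConnected μ I) (hI' : S.MuConnected μ I')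
    (w w' : V ≃ₗ[ℝ] V) (hw : w ∈ S.W) (hw' : w' ∈ S.W) :
    (fun x => w x) '' S.face μ I ⊆ (fun x => w' x) '' S.face μ I' ↔
      I ⊆ I' ∧ ∃ a ∈ S.WI (S.starSet μ I), ∃ b ∈ S.WI I', w⁻¹ * w' = a * b := by
  have hiff : (fun x => w x) '' S.face μ I ⊆ (fun x => w' x) '' S.face μ I' ↔
      ∀ x ∈ S.face μ I, ∃ y ∈ S.face μ I', (w⁻¹ * w') y = x := by
    rw [Set.image_subset_iff]
    refine forall₂_congr fun x _ => ?_
    simp only [Set.mem_preimage, Set.mem_image]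
    refine exists_congr fun y => and_congr_right fun _ => ?_
    constructor
    · intro h
      rw [LinearEquiv.mul_apply, h, ← LinearEquiv.mul_apply, inv_mul_cancel]; rfl
    · intro h
      rw [← h, ← LinearEquiv.mul_apply, ← mul_assoc, mul_inv_cancel, one_mul]
  rw [hiff]
  constructor
  · exact S.forward hμ hI (mul_mem (inv_mem hw) hw')
  · rintro ⟨h, a, ha, b, hb, hab⟩ x hx
    rw [hab]
    exact S.backward h ha hb hx
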